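/- Let (M,d) be a (possibly unbounded) metric space and T : M → M a mapping satisfying d(Tx,Ty) ≤ D(x, o_T(y)) for all x, y ∈ M whenever o_T(y) is bounded. Then either the orbit o_T(x) is bounded for every x ∈ M, or the orbit o_T(x) is unbounded for every x ∈ M. -/

import Mathlib

open Metric Set

/-- The orbit of `x` under `T`: `{x} ∪ {Tⁿ x : n ≥ 1}`. -/
def orbitOf {M : Type*} (T : M → M) (x : M) : Set M :=
  Set.range fun n : ℕ => T^[n] x

/-- `D(x,A) = sup { d(x,a) : a ∈ A }`. -/
noncomputable def Dsup {M : Type*} [MetricSpace M] (x : M) (A : Set M) : ℝ :=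
  sSup (dist x '' A)

/-- A self-map `T` is orbit-nonexpansive if `d(Tx,Ty) ≤ D(x, o_T(y))` for all `x,y`. -/
def OrbitNonexpansive {M : Type*} [MetricSpace M] (T : M → M) : Prop :=
  ∀ x y : M, dist (T x) (T y) ≤ Dsup x (orbitOf T y)

/-- A set is admissible if it is an intersection of closed balls. -/
def Admissible {M : Type*} [MetricSpace M] (A : Set M) : Prop :=
  ∃ C : Set (M × ℝ), A = ⋂ p ∈ C, Metric.closedBall p.1 p.2

/-- The family of admissible sets is compact: any collection of admissible sets whose
finite subcollections have nonempty intersection has nonempty intersection. -/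
def AdmissibleCompact (M : Type*) [MetricSpace M] : Prop :=
  ∀ 𝒞 : Set (Set M), (∀ A ∈ 𝒞, Admissible A) →
    (∀ 𝒟 ⊆ 𝒞, 𝒟.Finite → (⋂₀ 𝒟).Nonempty) → (⋂₀ 𝒞).Nonempty

/-- Metric normal structure: every admissible set with more than one point contains a
point `z` with `D(z,A) < δ(A)`. -/
def MetricNormalStructure (M : Type*) [MetricSpace M] : Prop :=
  ∀ A : Set M, Admissible A → A.Nontrivial → ∃ z ∈ A, Dsup z A < Metric.diam A

/-- `D` is a one-local retract of `M`: any family of closed balls centered in `D` with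
nonempty intersection meets `D`. -/
def OneLocalRetract {M : Type*} [MetricSpace M] (D : Set M) : Prop :=
  ∀ C : Set (M × ℝ), (∀ p ∈ C, p.1 ∈ D) →
    (⋂ p ∈ C, Metric.closedBall p.1 p.2).Nonempty →
    ((⋂ p ∈ C, Metric.closedBall p.1 p.2) ∩ D).Nonempty

/-- A family `F` of self-maps is interlaced orbit-nonexpansive if
`d(Tx,Sy) ≤ sup { D(x, o_R(y)) : R ∈ F }` for all `T,S ∈ F` and `x,y ∈ M`. -/
def InterlacedFamily {M : Type*} [MetricSpace M] (F : Set (M → M)) : Prop :=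
  ∀ T ∈ F, ∀ S ∈ F, ∀ x y : M,
    dist (T x) (S y) ≤ sSup ((fun R => Dsup x (orbitOf R y)) '' F)

/-- `B[A,r] = ⋂_{x ∈ A} B̄(x,r)`. -/
def Bball {M : Type*} [MetricSpace M] (A : Set M) (r : ℝ) : Set M :=
  ⋂ x ∈ A, Metric.closedBall x r

theorem isBounded_orbitOf_iterate {M : Type*} [MetricSpace M] {T : M → M} {y : M}
    (hy : Bornology.IsBounded (orbitOf T y)) (k : ℕ) :
    Bornology.IsBounded (orbitOf T (T^[k] y)) := by
  refine hy.subset ?_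
  rintro _ ⟨j, rfl⟩
  exact ⟨j + k, Function.iterate_add_apply T j k y⟩

theorem dist_le_Dsup {M : Type*} [MetricSpace M] {A : Set M} (hA : Bornology.IsBounded A)
    (x : M) {a : M} (ha : a ∈ A) : dist x a ≤ Dsup x A := by
  obtain ⟨r, hr⟩ := hA.subset_closedBall x
  refine le_csSup ⟨r, ?_⟩ ⟨a, ha, rfl⟩
  rintro _ ⟨b, hb, rfl⟩
  rw [dist_comm]
  exact hr hb

/-- The `n`-th iterate of `x` stays within `D(x, o_T(y))` of all iterates of `y` of order
at least `n`. -/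
theorem dist_iterate_le_Dsup {M : Type*} [MetricSpace M] {T : M → M}
    (hT : ∀ x y : M, Bornology.IsBounded (orbitOf T y) →
      dist (T x) (T y) ≤ Dsup x (orbitOf T y))
    {y : M} (hy : Bornology.IsBounded (orbitOf T y)) (x : M) (n : ℕ) :
    ∀ k, n ≤ k → dist (T^[n] x) (T^[k] y) ≤ Dsup x (orbitOf T y) := by
  induction n with
  | zero => exact fun k _ => dist_le_Dsup hy x ⟨k, rfl⟩
  | succ n ih =>
    intro k hk
    obtain ⟨k, rfl⟩ : ∃ m, k = m + 1 := ⟨k - 1, by omega⟩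
    rw [Function.iterate_succ_apply', Function.iterate_succ_apply']
    refine (hT _ _ (isBounded_orbitOf_iterate hy k)).trans ?_
    refine csSup_le ((range_nonempty _).image _) ?_
    rintro _ ⟨_, ⟨j, rfl⟩, rfl⟩
    simp only [← Function.iterate_add_apply]
    exact ih (j + k) (by omega)

theorem stmt15 {M : Type*} [MetricSpace M] (T : M → M)
    (hT : ∀ x y : M, Bornology.IsBounded (orbitOf T y) →
      dist (T x) (T y) ≤ Dsup x (orbitOf T y)) :
    (∀ x : M, Bornology.IsBounded (orbitOf T x)) ∨
      (∀ x : M, ¬ Bornology.IsBounded (orbitOf T x)) := by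
  by_cases h : ∃ y, Bornology.IsBounded (orbitOf T y)
  · obtain ⟨y, hy⟩ := h
    refine Or.inl fun x => ?_
    refine (hy.cthickening (δ := Dsup x (orbitOf T y))).subset ?_
    rintro _ ⟨n, rfl⟩
    exact mem_cthickening_of_dist_le _ (T^[n] y) _ _ ⟨n, rfl⟩
      (dist_iterate_le_Dsup hT hy x n n le_rfl)
  · exact Or.inr (not_exists.mp h)
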